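/- Let A be a C*-algebra, I ⊆ A an ideal, and let (C_x)_{x ∈ X} be a convex approximate unit for I indexed by a directed set (meaning each C_x ∈ I with 0 ≤ C_x ≤ 1, the family is convex and C_x y → y for all y ∈ I). Then for every b ∈ A and every bounded linear functional Φ on A (or on I), lim inf over the convex approximate unit of |Φ(C_x b − b C_x)| = 0; that is, one cannot separate 0 from the convex set {C_x b − b C_x : x} uniformly by a bounded functional. -/

import Mathlib

open Filter Topology

/-- a phase rotating a complex number to its absolute value -/
lemma aux_phase (z : ℂ) : ∃ u : ℂ, ‖u‖ = 1 ∧ u * z = (‖z‖ : ℂ) := by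
  by_cases hz : z = 0
  · exact ⟨1, by simp, by simp [hz]⟩
  · have hz' : (‖z‖ : ℂ) ≠ 0 := by simpa using hz
    refine ⟨(‖z‖ : ℂ) / z, ?_, ?_⟩
    · simp [hz]
    · field_simp

lemma aux_norm {A : Type*} [CStarAlgebra A] (a d : A) (t : ℝ) (ht : 0 ≤ t)
    (ha : ‖a‖ ≤ 1) (hd : ‖d‖ ≤ 1) (had : ‖star a * d‖ ≤ t) :
    ‖a + (t : ℂ) • d‖ ≤ 1 + 3 * t ^ 2 / 2 := by
  have h1 : ‖a + (t : ℂ) • d‖ * ‖a + (t : ℂ) • d‖ ≤ 1 + 3 * t ^ 2 := by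
    rw [← CStarRing.norm_star_mul_self]
    have e : star (a + (t : ℂ) • d) * (a + (t : ℂ) • d)
        = star a * a + (t : ℂ) • (star a * d) + (t : ℂ) • star (star a * d)
          + (t : ℂ) • (t : ℂ) • (star d * d) := by
      simp only [star_add, star_smul, star_mul, star_star, add_mul, mul_add, smul_mul_assoc,
        mul_smul_comm, smul_add, Complex.star_def, Complex.conj_ofReal]
      abel
    rw [e]
    have n1 : ‖star a * a‖ ≤ 1 := by
      rw [CStarRing.norm_star_mul_self]; nlinarith [norm_nonneg a]
    have n4 : ‖star d * d‖ ≤ 1 := by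
      rw [CStarRing.norm_star_mul_self]; nlinarith [norm_nonneg d]
    refine (norm_add_le _ _).trans ?_
    refine (add_le_add (norm_add_le _ _) le_rfl).trans ?_
    refine (add_le_add (add_le_add (norm_add_le _ _) le_rfl) le_rfl).trans ?_
    simp only [norm_smul, norm_star, Complex.norm_real, Real.norm_eq_abs, abs_of_nonneg ht]
    have := mul_le_mul_of_nonneg_left had ht
    have := mul_le_mul_of_nonneg_left n4 (mul_nonneg ht ht)
    nlinarith
  nlinarith [norm_nonneg (a + (t : ℂ) • d), sq_nonneg (t ^ 2)]

lemma aux_small {A : Type*} [CStarAlgebra A] [PartialOrder A] [StarOrderedRing A]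
    (I : Ideal A) (hIstar : ∀ x ∈ I, star x ∈ I)
    {X : Type*} [SemilatticeSup X] [Nonempty X]
    (C : X → A) (hC0 : ∀ x, 0 ≤ C x) (hC1 : ∀ x, C x ≤ 1)
    (hCI : ∀ x, C x ∈ I) (hr : ∀ y ∈ I, ∀ c : A, y * c ∈ I)
    (happrox : ∀ y ∈ I, Tendsto (fun x => y * C x) atTop (nhds y))
    (Φ : A →L[ℂ] ℂ) (η : ℝ) (hη : 0 < η) :
    ∃ z, ∀ y ∈ I, ‖y‖ ≤ 1 → ‖Φ ((1 - C z) * y)‖ ≤ η := by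
  have hsm : ∀ (u : ℂ) (y : A), y ∈ I → u • y ∈ I := fun u y hy => by
    have := I.mul_mem_left (u • (1 : A)) hy
    simpa using this
  let S : Submodule ℂ A := I.restrictScalars ℂ
  let φ : S →L[ℂ] ℂ := Φ.comp S.subtypeL
  set M := ‖φ‖ with hM
  have hM0 : 0 ≤ M := by rw [hM]; exact norm_nonneg φ
  have hle : ∀ w ∈ I, ‖Φ w‖ ≤ M * ‖w‖ := fun w hw => φ.le_opNorm ⟨w, hw⟩
  set t := η / (1 + 2 * M) with ht
  have ht0 : 0 < t := by positivity
  have htη : t * (1 + 2 * M) = η := by rw [ht]; field_simp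
  obtain ⟨y0, hy0I, hy0, hy0Φ⟩ : ∃ y0 ∈ I, ‖y0‖ ≤ 1 ∧ M - t ^ 2 ≤ ‖Φ y0‖ := by
    obtain ⟨x, hx1, hx2⟩ := φ.exists_lt_apply_of_lt_opNorm
      (show M - t ^ 2 < ‖φ‖ by rw [← hM]; nlinarith [sq_pos_of_pos ht0])
    exact ⟨x.1, x.2, hx1.le, hx2.le⟩
  obtain ⟨u, hu, huΦ⟩ := aux_phase (Φ y0)
  set a := u • y0 with ha
  have haI : a ∈ I := hsm u y0 hy0I
  have hna : ‖a‖ ≤ 1 := by rw [ha, norm_smul, hu, one_mul]; exact hy0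
  have haΦ : Φ a = (‖Φ y0‖ : ℂ) := by rw [ha, map_smul, smul_eq_mul, huΦ]
  have hev := Metric.tendsto_nhds.1 (happrox (star a) (hIstar a haI)) t ht0
  obtain ⟨z, hz⟩ := hev.exists
  refine ⟨z, fun y hy hy1 => ?_⟩
  have he : ‖1 - C z‖ ≤ 1 :=
    (CStarAlgebra.norm_le_one_iff_of_nonneg _ (sub_nonneg.2 (hC1 z))).2
      (sub_le_self _ (hC0 z))
  obtain ⟨v, hv, hvΦ⟩ := aux_phase (Φ ((1 - C z) * y))
  set d := v • ((1 - C z) * y) with hd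
  have hdI : d ∈ I := hsm v _ (I.mul_mem_left _ hy)
  have hdΦ : Φ d = (‖Φ ((1 - C z) * y)‖ : ℂ) := by rw [hd, map_smul, smul_eq_mul, hvΦ]
  have hnd : ‖d‖ ≤ 1 := by
    rw [hd, norm_smul, hv, one_mul]
    exact (norm_mul_le _ _).trans (mul_le_one₀ he (norm_nonneg _) hy1)
  have had : ‖star a * d‖ ≤ t := by
    have e : star a * d = v • ((star a - star a * C z) * y) := by
      rw [hd, mul_smul_comm, ← mul_assoc, mul_sub, mul_one]
    rw [e, norm_smul, hv, one_mul]
    rw [dist_eq_norm, norm_sub_rev] at hz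
    refine (norm_mul_le _ _).trans ?_
    nlinarith [norm_nonneg y, norm_nonneg (star a - star a * C z)]
  have hn := aux_norm a d t ht0.le hna hnd had
  have hΦ := hle (a + (t : ℂ) • d) (I.add_mem haI (hsm _ _ hdI))
  rw [map_add, haΦ, map_smul Φ (t : ℂ) d, hdΦ, smul_eq_mul, ← Complex.ofReal_mul, ← Complex.ofReal_add,
    Complex.norm_real, Real.norm_eq_abs, abs_of_nonneg (by positivity)] at hΦ
  have h2 := mul_le_mul_of_nonneg_left hn hM0
  have h3 : t * ‖Φ ((1 - C z) * y)‖ ≤ t * η := by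
    rw [← htη]
    nlinarith [mul_nonneg hM0 (sq_nonneg t)]
  exact le_of_mul_le_mul_left h3 ht0

theorem stmt_17 {A : Type*} [CStarAlgebra A] [PartialOrder A] [StarOrderedRing A]
    (I : Ideal A) (hIclosed : IsClosed (I : Set A)) (hIstar : ∀ x ∈ I, star x ∈ I)
    {X : Type*} [SemilatticeSup X] [Nonempty X]
    (C : X → A) (hCI : ∀ x, C x ∈ I) (hC0 : ∀ x, 0 ≤ C x) (hC1 : ∀ x, C x ≤ 1)
    (hconvex : ∀ (x₁ x₂ : X) (t : ℝ), 0 ≤ t → t ≤ 1 →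
      ∃ x₃, C x₃ = t • C x₁ + (1 - t) • C x₂)
    (happrox : ∀ y ∈ I, Tendsto (fun x => C x * y) atTop (nhds y) ∧
      Tendsto (fun x => y * C x) atTop (nhds y))
    (b : A) (Φ : A →L[ℂ] ℂ) :
    Filter.liminf (fun x => ‖Φ (C x * b - b * C x)‖) atTop = 0 := by
  have hr : ∀ y ∈ I, ∀ c : A, y * c ∈ I := fun y hy c => by
    have := hIstar _ (I.mul_mem_left (star c) (hIstar y hy))
    simpa using this
  apply Tendsto.liminf_eq
  rw [Metric.tendsto_nhds]
  intro ε hε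
  set R := 2 * ‖b‖ + 1 with hR
  have hR0 : 0 < R := by positivity
  obtain ⟨z, hz⟩ := aux_small I hIstar C hC0 hC1 hCI hr (fun y hy => (happrox y hy).2) Φ
    (ε / (2 * R)) (by positivity)
  have hlim : Tendsto (fun x => Φ (C z * (C x * b - b * C x))) atTop (nhds 0) := by
    have h1 := ((happrox (C z) (hCI z)).2).mul_const b
    have h2 := (happrox (C z * b) (hr _ (hCI z) b)).2
    have h3 := (Φ.continuous.tendsto _).comp (h1.sub h2)
    simpa [Function.comp_def, mul_sub, mul_assoc] using h3
  filter_upwards [Metric.tendsto_nhds.1 hlim (ε / 2) (by positivity)] with x hx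
  rw [dist_zero_right] at hx ⊢
  rw [norm_norm]
  set y := C x * b - b * C x with hy
  have hyI : y ∈ I := I.sub_mem (hr _ (hCI x) b) (I.mul_mem_left _ (hCI x))
  have hCx : ‖C x‖ ≤ 1 := (CStarAlgebra.norm_le_one_iff_of_nonneg _ (hC0 x)).2 (hC1 x)
  have hyR : ‖y‖ ≤ R := by
    have e1 := norm_sub_le (C x * b) (b * C x)
    have e2 := norm_mul_le (C x) b
    have e3 := norm_mul_le b (C x)
    have e4 := mul_le_mul_of_nonneg_right hCx (norm_nonneg b)
    rw [← hy] at e1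
    nlinarith
  have hk := hz (((R⁻¹ : ℝ) : ℂ) • y)
    (by simpa using I.mul_mem_left ((((R⁻¹ : ℝ) : ℂ)) • (1 : A)) hyI)
    (by
      rw [norm_smul, Complex.norm_real, Real.norm_eq_abs, abs_of_pos (inv_pos.2 hR0)]
      rw [inv_mul_le_iff₀ hR0]; linarith)
  rw [mul_smul_comm, map_smul, norm_smul, Complex.norm_real, Real.norm_eq_abs,
    abs_of_pos (inv_pos.2 hR0), inv_mul_le_iff₀ hR0] at hk
  have e : R * (ε / (2 * R)) = ε / 2 := by field_simp
  rw [e] at hk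
  have e5 : Φ y = Φ ((1 - C z) * y) + Φ (C z * y) := by
    rw [← map_add, ← add_mul]; simp
  rw [e5]
  have := norm_add_le (Φ ((1 - C z) * y)) (Φ (C z * y))
  linarith
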